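/- Let φ : R → S be a homomorphism of commutative rings. Then the multiplication map μ : S ⊗_R S → S, s ⊗ t ↦ st, is bijective and Tor_i^R(S, S) = 0 for all i ≥ 1 if and only if the functor D(φ) : D(S) → D(R) between unbounded derived categories induced by restriction of scalars is fully faithful. -/

import Mathlib

/-!
Homological epimorphisms of rings (Geigle–Lenzing).
`φ : R →+* S`; every `S`-module is an `R`-module by restriction of scalars.
-/

universe w u

open CategoryTheory Limits DerivedCategory

noncomputable section

namespace RingHomEpi

variable {R S : Type u} [CommRing R] [CommRing S] (φ : R →+* S)

instance : (ModuleCat.restrictScalars.{u} φ).Additive where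
  map_add := rfl

/-- `S` regarded as an `R`-module via `φ`. -/
abbrev SasR : ModuleCat.{u} R := (ModuleCat.restrictScalars φ).obj (ModuleCat.of S S)

/-- The canonical map `η_M : M → Hom_R(S, M)`, `m ↦ (s ↦ s • m)`. -/
def etaMap (M : ModuleCat.{u} S) :
    M → (SasR φ →ₗ[R] (ModuleCat.restrictScalars φ).obj M) := fun m =>
  { toFun := fun s => (show S from s) • (show M from m)
    map_add' := fun s t => add_smul (show S from s) (show S from t) (show M from m)
    map_smul' := fun r s => by
      show (φ r • (show S from s)) • (show M from m) =
        φ r • ((show S from s) • (show M from m))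
      exact smul_assoc (φ r) (show S from s) (show M from m) }

/-- The action of `S` on an `S`-module `M`, as an `R`-bilinear map. -/
def actionBilin (M : ModuleCat.{u} S) :
    SasR φ →ₗ[R]
      ((ModuleCat.restrictScalars φ).obj M →ₗ[R] (ModuleCat.restrictScalars φ).obj M) where
  toFun s :=
    { toFun := fun m => (show S from s) • (show M from m)
      map_add' := fun m m' => smul_add (show S from s) (show M from m) (show M from m')
      map_smul' := fun r m => by
        show (show S from s) • (φ r • (show M from m)) =
          φ r • ((show S from s) • (show M from m))
        rw [smul_comm] }
  map_add' s t := LinearMap.ext fun m => add_smul (show S from s) (show S from t) (show M from m)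
  map_smul' r s := LinearMap.ext fun m => by
    show (φ r • (show S from s)) • (show M from m) =
      φ r • ((show S from s) • (show M from m))
    exact smul_assoc (φ r) (show S from s) (show M from m)

/-- The action map `α_M : S ⊗_R M → M`, `s ⊗ m ↦ s • m`. -/
def actionMap (M : ModuleCat.{u} S) :
    TensorProduct R (SasR φ) ((ModuleCat.restrictScalars φ).obj M) →ₗ[R]
      (ModuleCat.restrictScalars φ).obj M :=
  TensorProduct.lift (actionBilin φ M)

/-- The multiplication map `μ : S ⊗_R S → S`, `s ⊗ t ↦ s * t`. -/
def mulMap : TensorProduct R (SasR φ) (SasR φ) →ₗ[R] SasR φ :=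
  actionMap φ (ModuleCat.of S S)

/-- Restriction of scalars is compatible with the forgetful functors to abelian groups. -/
def restrictScalarsCompForget₂Iso :
    ModuleCat.restrictScalars.{u} φ ⋙ forget₂ (ModuleCat.{u} R) AddCommGrpCat ≅
      forget₂ (ModuleCat.{u} S) AddCommGrpCat :=
  NatIso.ofComponents (fun _ => Iso.refl _) (fun _ => rfl)

instance : PreservesFiniteLimits (ModuleCat.restrictScalars.{u} φ) := by
  have : PreservesFiniteLimits
      (ModuleCat.restrictScalars.{u} φ ⋙ forget₂ (ModuleCat.{u} R) AddCommGrpCat) :=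
    preservesFiniteLimits_of_natIso (restrictScalarsCompForget₂Iso φ).symm
  exact preservesFiniteLimits_of_reflects_of_preserves _
    (forget₂ (ModuleCat.{u} R) AddCommGrpCat)

instance : PreservesFiniteColimits (ModuleCat.restrictScalars.{u} φ) := by
  have : PreservesFiniteColimits
      (ModuleCat.restrictScalars.{u} φ ⋙ forget₂ (ModuleCat.{u} R) AddCommGrpCat) :=
    preservesFiniteColimits_of_natIso (restrictScalarsCompForget₂Iso φ).symm
  exact preservesFiniteColimits_of_reflects_of_preserves _
    (forget₂ (ModuleCat.{u} R) AddCommGrpCat)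

attribute [local instance] CategoryTheory.hasExt_of_hasDerivedCategory

variable [HasDerivedCategory.{w} (ModuleCat.{u} R)]
  [HasDerivedCategory.{w} (ModuleCat.{u} S)]

/-- The functor `D(φ) : D(S) → D(R)` induced by restriction of scalars along `φ`. -/
abbrev Dphi : DerivedCategory (ModuleCat.{u} S) ⥤ DerivedCategory (ModuleCat.{u} R) :=
  (ModuleCat.restrictScalars.{u} φ).mapDerivedCategory

/-- `D(φ)` commutes with the single complex functors. -/
def singleObjIso (M : ModuleCat.{u} S) :
    (Dphi φ).obj ((DerivedCategory.singleFunctor (ModuleCat.{u} S) 0).obj M) ≅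
      (DerivedCategory.singleFunctor (ModuleCat.{u} R) 0).obj
        ((ModuleCat.restrictScalars φ).obj M) :=
  (Dphi φ).mapIso
    (((SingleFunctors.evaluation _ _ 0).mapIso
      (DerivedCategory.singleFunctorsPostcompQIso (ModuleCat.{u} S))).app M)
  ≪≫ ((ModuleCat.restrictScalars.{u} φ).mapDerivedCategoryFactors.app _)
  ≪≫ DerivedCategory.Q.mapIso
      ((HomologicalComplex.singleMapHomologicalComplex
        (ModuleCat.restrictScalars.{u} φ) (ComplexShape.up ℤ) 0).app M)
  ≪≫ (((SingleFunctors.evaluation _ _ 0).mapIso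
      (DerivedCategory.singleFunctorsPostcompQIso (ModuleCat.{u} R))).symm.app _)

/-- The natural comparison map `Ext^n_S(M, M') → Ext^n_R(M, M')` induced by
restriction of scalars along `φ`. -/
def extMap {M M' : ModuleCat.{u} S} {n : ℕ} (e : Abelian.Ext M M' n) :
    Abelian.Ext ((ModuleCat.restrictScalars φ).obj M)
      ((ModuleCat.restrictScalars φ).obj M') n :=
  Abelian.Ext.homEquiv.symm
    ((singleObjIso φ M).inv ≫ (Dphi φ).map e.hom ≫
      ((Dphi φ).commShiftIso (n : ℤ)).hom.app _ ≫
      (shiftFunctor (DerivedCategory (ModuleCat.{u} R)) (n : ℤ)).map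
        (singleObjIso φ M').hom)



universe w₁ w₂ v₁ v₂ u₁ u₂

section General

variable {C : Type u₁} [Category.{v₁} C] [Abelian C]
  {D : Type u₂} [Category.{v₂} D] [Abelian D]

/-- The unit on complexes. -/
def mapUnit {F : C ⥤ D} {G : D ⥤ C} [F.Additive] [G.Additive] (adj : F ⊣ G)
    {ι : Type*} (c : ComplexShape ι) :
    𝟭 _ ⟶ F.mapHomologicalComplex c ⋙ G.mapHomologicalComplex c where
  app K :=
    { f := fun i => adj.unit.app (K.X i)
      comm' := fun i j _ => (adj.unit.naturality (K.d i j)).symm }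
  naturality K K' f := by
    ext i
    exact adj.unit.naturality (f.f i)

/-- The counit on complexes. -/
def mapCounit {F : C ⥤ D} {G : D ⥤ C} [F.Additive] [G.Additive] (adj : F ⊣ G)
    {ι : Type*} (c : ComplexShape ι) :
    G.mapHomologicalComplex c ⋙ F.mapHomologicalComplex c ⟶ 𝟭 _ where
  app K :=
    { f := fun i => adj.counit.app (K.X i)
      comm' := fun i j _ => (adj.counit.naturality (K.d i j)).symm }
  naturality K K' f := by
    ext i
    exact adj.counit.naturality (f.f i)

/-- An adjunction between additive functors extends to complexes. -/
def mapAdj {F : C ⥤ D} {G : D ⥤ C} [F.Additive] [G.Additive] (adj : F ⊣ G)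
    {ι : Type*} (c : ComplexShape ι) :
    F.mapHomologicalComplex c ⊣ G.mapHomologicalComplex c where
  unit := mapUnit adj c
  counit := mapCounit adj c
  left_triangle_components K := by
    ext i
    exact adj.left_triangle_components (K.X i)
  right_triangle_components K := by
    ext i
    exact adj.right_triangle_components (K.X i)

lemma acyclic_map (F : C ⥤ D) [F.Additive] [PreservesFiniteLimits F]
    [PreservesFiniteColimits F] {K : CochainComplex C ℤ} (hK : K.Acyclic) :
    ((F.mapHomologicalComplex (.up ℤ)).obj K).Acyclic := by
  intro n
  have := hK n
  rw [HomologicalComplex.exactAt_iff] at this ⊢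
  exact this.map F

lemma isKInjective_map {F : C ⥤ D} [F.Additive] [PreservesFiniteLimits F]
    [PreservesFiniteColimits F] {G : D ⥤ C} [G.Additive] (adj : F ⊣ G) (I : CochainComplex D ℤ) [I.IsKInjective] :
    CochainComplex.IsKInjective ((G.mapHomologicalComplex (.up ℤ)).obj I) where
  nonempty_homotopy_zero {K} f hK := by
    let A := mapAdj adj (.up ℤ)
    obtain ⟨h⟩ := CochainComplex.IsKInjective.nonempty_homotopy_zero
      ((A.homEquiv _ _).symm f) (acyclic_map F hK)
    have h' := (G.mapHomotopy h).compLeft (A.unit.app K)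
    refine ⟨(Homotopy.ofEq ?_).trans (h'.trans (.ofEq ?_))⟩
    · exact ((A.homEquiv _ _).apply_symm_apply f).symm.trans (A.homEquiv_unit ..)
    · simp

lemma isKProjective_map {F : C ⥤ D} [F.Additive] [PreservesFiniteLimits F]
    [PreservesFiniteColimits F] {L : D ⥤ C} [L.Additive] (adj : L ⊣ F) (P : CochainComplex D ℤ) [P.IsKProjective] :
    CochainComplex.IsKProjective ((L.mapHomologicalComplex (.up ℤ)).obj P) where
  nonempty_homotopy_zero {K} f hK := by
    let A := mapAdj adj (.up ℤ)
    obtain ⟨h⟩ := CochainComplex.IsKProjective.nonempty_homotopy_zero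
      (A.homEquiv _ _ f) (acyclic_map F hK)
    have h' := (L.mapHomotopy h).compRight (A.counit.app K)
    refine ⟨(Homotopy.ofEq ?_).trans (h'.trans (.ofEq ?_))⟩
    · exact ((A.homEquiv _ _).symm_apply_apply f).symm.trans (A.homEquiv_counit ..)
    · simp

variable [HasDerivedCategory.{w₁} C] [HasDerivedCategory.{w₂} D]

lemma Q_map_surjective_of_inj (K I : CochainComplex C ℤ) [I.IsKInjective] :
    Function.Surjective (Q.map : (K ⟶ I) → _) := by
  intro g
  obtain ⟨a, ha⟩ := (CochainComplex.IsKInjective.Qh_map_bijective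
    ((HomotopyCategory.quotient _ _).obj K) I).surjective
    ((quotientCompQhIso C).hom.app K ≫ g ≫ (quotientCompQhIso C).inv.app I)
  obtain ⟨b, rfl⟩ := (HomotopyCategory.quotient _ _).map_surjective a
  refine ⟨b, ?_⟩
  have := (quotientCompQhIso C).hom.naturality b
  rw [← cancel_epi ((quotientCompQhIso C).hom.app K), ← this]
  dsimp
  rw [ha]
  simp

lemma homotopy_of_inj {K I : CochainComplex C ℤ} [I.IsKInjective] {f g : K ⟶ I}
    (h : Q.map f = Q.map g) : Nonempty (Homotopy f g) := by
  refine ⟨HomotopyCategory.homotopyOfEq _ _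
    ((CochainComplex.IsKInjective.Qh_map_bijective _ I).injective ?_)⟩
  have h1 := (quotientCompQhIso C).hom.naturality f
  have h2 := (quotientCompQhIso C).hom.naturality g
  rw [h, ← h2] at h1
  exact (cancel_mono _).1 h1

lemma Q_map_surjective_of_proj (P K : CochainComplex C ℤ) [P.IsKProjective] :
    Function.Surjective (Q.map : (P ⟶ K) → _) := by
  intro g
  obtain ⟨a, ha⟩ := (CochainComplex.IsKProjective.Qh_map_bijective P
    ((HomotopyCategory.quotient _ _).obj K)).surjective
    ((quotientCompQhIso C).hom.app P ≫ g ≫ (quotientCompQhIso C).inv.app K)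
  obtain ⟨b, rfl⟩ := (HomotopyCategory.quotient _ _).map_surjective a
  refine ⟨b, ?_⟩
  have := (quotientCompQhIso C).hom.naturality b
  rw [← cancel_epi ((quotientCompQhIso C).hom.app P), ← this]
  dsimp
  rw [ha]
  simp

lemma homotopy_of_proj {P K : CochainComplex C ℤ} [P.IsKProjective] {f g : P ⟶ K}
    (h : Q.map f = Q.map g) : Nonempty (Homotopy f g) := by
  refine ⟨HomotopyCategory.homotopyOfEq _ _
    ((CochainComplex.IsKProjective.Qh_map_bijective P _).injective ?_)⟩
  have h1 := (quotientCompQhIso C).hom.naturality f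
  have h2 := (quotientCompQhIso C).hom.naturality g
  rw [h, ← h2] at h1
  exact (cancel_mono _).1 h1

variable (F : C ⥤ D) [F.Additive] [PreservesFiniteLimits F] [PreservesFiniteColimits F]

section Right

variable {F} {G : D ⥤ C} [G.Additive] (adj : F ⊣ G)

lemma right_bijective (Y : CochainComplex C ℤ) (I : CochainComplex D ℤ) [I.IsKInjective] :
    Function.Bijective (fun g : Q.obj Y ⟶ Q.obj ((G.mapHomologicalComplex (.up ℤ)).obj I) =>
      F.mapDerivedCategory.map g ≫ F.mapDerivedCategoryFactors.hom.app _ ≫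
        Q.map ((mapAdj adj (.up ℤ)).counit.app I)) := by
  have := isKInjective_map adj I
  let A := mapAdj adj (.up ℤ)
  have key (b : Y ⟶ (G.mapHomologicalComplex (.up ℤ)).obj I) :
      F.mapDerivedCategory.map (Q.map b) ≫ F.mapDerivedCategoryFactors.hom.app _ ≫
        Q.map (A.counit.app I) = F.mapDerivedCategoryFactors.hom.app _ ≫
          Q.map ((A.homEquiv _ _).symm b) := by
    rw [F.mapDerivedCategoryFactors_hom_naturality_assoc, ← Q.map_comp]
    rw [A.homEquiv_counit]
  constructor
  · intro g g' h
    obtain ⟨b, rfl⟩ := Q_map_surjective_of_inj _ _ g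
    obtain ⟨b', rfl⟩ := Q_map_surjective_of_inj _ _ g'
    dsimp only at h
    rw [key, key, cancel_epi] at h
    obtain ⟨h⟩ := homotopy_of_inj (I := I) h
    have h' := (G.mapHomotopy h).compLeft (A.unit.app Y)
    refine Q_map_eq_of_homotopy _ ((Homotopy.ofEq ?_).trans (h'.trans (.ofEq ?_)))
    · exact ((A.homEquiv _ _).apply_symm_apply b).symm.trans (A.homEquiv_unit ..)
    · exact (((A.homEquiv _ _).apply_symm_apply b').symm.trans (A.homEquiv_unit ..)).symm
  · intro h
    obtain ⟨a, ha⟩ := Q_map_surjective_of_inj _ I (F.mapDerivedCategoryFactors.inv.app _ ≫ h)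
    refine ⟨Q.map (A.homEquiv _ _ a), ?_⟩
    dsimp only
    rw [key, Equiv.symm_apply_apply, ha, Iso.hom_inv_id_app_assoc]

end Right

section Left

variable {F} {L : D ⥤ C} [L.Additive] (adj : L ⊣ F)

lemma left_bijective (P : CochainComplex D ℤ) (M : CochainComplex C ℤ) [P.IsKProjective] :
    Function.Bijective (fun g : Q.obj ((L.mapHomologicalComplex (.up ℤ)).obj P) ⟶ Q.obj M =>
      Q.map ((mapAdj adj (.up ℤ)).unit.app P) ≫ F.mapDerivedCategoryFactors.inv.app _ ≫
      F.mapDerivedCategory.map g) := by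
  have := isKProjective_map adj P
  let A := mapAdj adj (.up ℤ)
  have key (b : (L.mapHomologicalComplex (.up ℤ)).obj P ⟶ M) :
      Q.map (A.unit.app P) ≫ F.mapDerivedCategoryFactors.inv.app _ ≫
      F.mapDerivedCategory.map (Q.map b) = Q.map (A.homEquiv _ _ b) ≫
        F.mapDerivedCategoryFactors.inv.app _ := by
    have := F.mapDerivedCategoryFactors.inv.naturality b
    dsimp at this
    rw [← this, A.homEquiv_unit, Q.map_comp, Category.assoc]
  constructor
  · intro g g' h
    obtain ⟨b, rfl⟩ := Q_map_surjective_of_proj _ _ g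
    obtain ⟨b', rfl⟩ := Q_map_surjective_of_proj _ _ g'
    dsimp only at h
    rw [key, key, cancel_mono] at h
    obtain ⟨h⟩ := homotopy_of_proj (P := P) h
    have h' := (L.mapHomotopy h).compRight (A.counit.app M)
    refine Q_map_eq_of_homotopy _ ((Homotopy.ofEq ?_).trans (h'.trans (.ofEq ?_)))
    · exact ((A.homEquiv _ _).symm_apply_apply b).symm.trans (A.homEquiv_counit ..)
    · exact (((A.homEquiv _ _).symm_apply_apply b').symm.trans (A.homEquiv_counit ..)).symm
  · intro h
    obtain ⟨a, ha⟩ := Q_map_surjective_of_proj P _ (h ≫ F.mapDerivedCategoryFactors.hom.app _)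
    refine ⟨Q.map ((A.homEquiv _ _).symm a), ?_⟩
    dsimp only
    rw [key, Equiv.apply_symm_apply, ha, Category.assoc, Iso.hom_inv_id_app]
    exact Category.comp_id _

end Left

end General

section Resolution

variable {R : Type u} [CommRing R]

/-- The product of a sequence of complexes. -/
def piC (K : ℕ → CochainComplex (ModuleCat.{u} R) ℤ) : CochainComplex (ModuleCat.{u} R) ℤ where
  X i := ModuleCat.of R (∀ n, (K n).X i)
  d i j := ModuleCat.ofHom (LinearMap.pi fun n => ((K n).d i j).hom ∘ₗ LinearMap.proj n)
  shape i j h := by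
    refine ModuleCat.hom_ext (LinearMap.ext fun x => funext fun n => ?_)
    exact congr($((K n).shape i j h) (x n))
  d_comp_d' i j k _ _ := by
    refine ModuleCat.hom_ext (LinearMap.ext fun x => funext fun n => ?_)
    exact congr($((K n).d_comp_d i j k) (x n))

/-- The projections of the product. -/
def piProj (K : ℕ → CochainComplex (ModuleCat.{u} R) ℤ) (n : ℕ) : piC K ⟶ K n where
  f i := ModuleCat.ofHom (LinearMap.proj n)
  comm' i j _ := by
    ext x
    rfl

/-- The map to the product. -/
def piLift {M : CochainComplex (ModuleCat.{u} R) ℤ} {K : ℕ → CochainComplex (ModuleCat.{u} R) ℤ}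
    (f : ∀ n, M ⟶ K n) : M ⟶ piC K where
  f i := ModuleCat.ofHom (LinearMap.pi fun n => ((f n).f i).hom)
  comm' i j _ := by
    ext x
    funext n
    exact congr($((f n).comm i j) x)

lemma piC_isKInjective (I : ℕ → CochainComplex (ModuleCat.{u} R) ℤ)
    (hI : ∀ n, (I n).IsKInjective) : (piC I).IsKInjective where
  nonempty_homotopy_zero {K} f hK := by
    have h n := (CochainComplex.IsKInjective.nonempty_homotopy_zero (f ≫ piProj I n) hK)
    let h' n := (h n).some
    let H (i j : ℤ) : K.X i ⟶ (piC I).X j :=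
      ModuleCat.ofHom (LinearMap.pi fun n => ((h' n).hom i j).hom)
    refine ⟨⟨H, ?_, ?_⟩⟩
    · intro i j hij
      refine ModuleCat.hom_ext (LinearMap.ext fun x => funext fun n => ?_)
      exact congr($((h' n).zero i j hij) x)
    · intro i
      rw [dNext_eq _ (show (ComplexShape.up ℤ).Rel i (i+1) by simp),
        prevD_eq _ (show (ComplexShape.up ℤ).Rel (i-1) i by simp)]
      refine ModuleCat.hom_ext (LinearMap.ext fun x => funext fun n => ?_)
      have := (h' n).comm i
      rw [dNext_eq _ (show (ComplexShape.up ℤ).Rel i (i+1) by simp),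
        prevD_eq _ (show (ComplexShape.up ℤ).Rel (i-1) i by simp)] at this
      exact congr($this x)

/-- Product of short complexes of complexes. -/
def piSC (S : ℕ → ShortComplex (CochainComplex (ModuleCat.{u} R) ℤ)) :
    ShortComplex (CochainComplex (ModuleCat.{u} R) ℤ) where
  X₁ := piC fun n => (S n).X₁
  X₂ := piC fun n => (S n).X₂
  X₃ := piC fun n => (S n).X₃
  f := piLift fun n => piProj _ n ≫ (S n).f
  g := piLift fun n => piProj _ n ≫ (S n).g
  zero := by
    ext i x
    funext n
    exact congr(($((S n).zero)).f i (x n))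

lemma acyclic_iff (K : CochainComplex (ModuleCat.{u} R) ℤ) :
    K.Acyclic ↔ ∀ i j k : ℤ, i + 1 = j → j + 1 = k → ∀ x : K.X j, K.d j k x = 0 → ∃ y, K.d i j y = x := by
  constructor
  · rintro h i j k rfl rfl x hx
    have := h (i+1)
    rw [HomologicalComplex.exactAt_iff' K i (i+1) (i+1+1) (by simp) (by simp),
      ShortComplex.moduleCat_exact_iff] at this
    exact this x hx
  · intro h i
    rw [HomologicalComplex.exactAt_iff' K (i-1) i (i+1) (by simp) (by simp),
      ShortComplex.moduleCat_exact_iff]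
    exact fun x hx => h (i-1) i (i+1) (by simp) (by simp) x hx

lemma piC_acyclic (K : ℕ → CochainComplex (ModuleCat.{u} R) ℤ) (hK : ∀ n, (K n).Acyclic) :
    (piC K).Acyclic := by
  rw [acyclic_iff]
  intro i j k h1 h2 x hx
  have := fun n => (acyclic_iff _).1 (hK n) i j k h1 h2 (x n) (congr_fun hx n)
  choose y hy using this
  exact ⟨y, funext hy⟩

lemma shortExact_of_elem (S : ShortComplex (CochainComplex (ModuleCat.{u} R) ℤ))
    (h1 : ∀ i, Function.Injective (S.f.f i)) (h3 : ∀ i, Function.Surjective (S.g.f i))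
    (h2 : ∀ i x, S.g.f i x = 0 → ∃ y, S.f.f i y = x) : S.ShortExact := by
  apply HomologicalComplex.shortExact_of_degreewise_shortExact
  intro i
  refine @ShortComplex.ShortExact.mk _ _ _ _ ?_ ?_ ?_
  · rw [ShortComplex.moduleCat_exact_iff]
    exact h2 i
  · exact (ModuleCat.mono_iff_injective _).2 (h1 i)
  · exact (ModuleCat.epi_iff_surjective _).2 (h3 i)

lemma piSC_shortExact (S : ℕ → ShortComplex (CochainComplex (ModuleCat.{u} R) ℤ))
    (hS : ∀ n, (S n).ShortExact) : (piSC S).ShortExact := by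
  have h n i := ((hS n).map_of_exact (HomologicalComplex.eval _ _ i))
  apply shortExact_of_elem
  · intro i x y hxy
    funext n
    have := (ModuleCat.mono_iff_injective _).1 (h n i).mono_f
    exact this (congr_fun hxy n)
  · intro i y
    have := fun n => (ModuleCat.epi_iff_surjective _).1 (h n i).epi_g (y n)
    choose x hx using this
    exact ⟨x, funext hx⟩
  · intro i x hx
    have := fun n => (ShortComplex.moduleCat_exact_iff _).1 (h n i).exact (x n) (congr_fun hx n)
    choose y hy using this
    exact ⟨y, funext hy⟩

/-- The filtration. -/
def fil (M : CochainComplex (ModuleCat.{u} R) ℤ) (n : ℕ) (i : ℤ) : Submodule R (M.X i) :=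
  (⨆ (_ : i < -n), ⊤) ⊔ ⨆ (j : ℤ) (_ : j < -n), LinearMap.range (M.d j i).hom

lemma fil_le_comap (M : CochainComplex (ModuleCat.{u} R) ℤ) (n : ℕ) (i j : ℤ) :
    fil M n i ≤ (fil M n j).comap (M.d i j).hom := by
  refine sup_le (iSup_le fun h => ?_) (iSup_le fun k => iSup_le fun h => ?_)
  · rintro x -
    refine Submodule.mem_sup_right ?_
    refine Submodule.mem_iSup_of_mem i (Submodule.mem_iSup_of_mem h ⟨x, rfl⟩)
  · rintro _ ⟨x, rfl⟩
    have := congr($(M.d_comp_d k i j) x)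
    simp only [Submodule.mem_comap]
    change (M.d k i ≫ M.d i j) x ∈ _
    rw [this]
    exact Submodule.zero_mem _

lemma fil_succ_le (M : CochainComplex (ModuleCat.{u} R) ℤ) (n : ℕ) (i : ℤ) :
    fil M (n+1) i ≤ fil M n i := by
  refine sup_le_sup (iSup_le fun h => ?_) (iSup_le fun k => iSup_le fun h => ?_)
  · exact le_iSup_of_le (by push_cast at h; lia) le_rfl
  · exact le_iSup_of_le k (le_iSup_of_le (by push_cast at h; lia) le_rfl)

lemma fil_eq_bot (M : CochainComplex (ModuleCat.{u} R) ℤ) (n : ℕ) (i : ℤ) (h : -n < i) :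
    fil M n i = ⊥ := by
  rw [eq_bot_iff]
  refine sup_le (iSup_le fun h => by lia) (iSup_le fun k => iSup_le fun h => ?_)
  rintro _ ⟨x, rfl⟩
  rw [M.shape k i (by simp; lia)]
  simp

lemma fil_eq_top (M : CochainComplex (ModuleCat.{u} R) ℤ) (n : ℕ) (i : ℤ) (h : i < -n) :
    fil M n i = ⊤ := by
  rw [eq_top_iff]
  exact le_sup_of_le_left (le_iSup_of_le h le_rfl)

/-- The quotient by the filtration. -/
def quo (M : CochainComplex (ModuleCat.{u} R) ℤ) (n : ℕ) : CochainComplex (ModuleCat.{u} R) ℤ where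
  X i := ModuleCat.of R (M.X i ⧸ fil M n i)
  d i j := ModuleCat.ofHom (Submodule.mapQ _ _ (M.d i j).hom (fil_le_comap M n i j))
  shape i j h := by
    refine ModuleCat.hom_ext (LinearMap.ext fun x => ?_)
    obtain ⟨x, rfl⟩ := Submodule.Quotient.mk_surjective _ x
    exact congr((fil M n j).mkQ ($(M.shape i j h) x))
  d_comp_d' i j k _ _ := by
    refine ModuleCat.hom_ext (LinearMap.ext fun x => ?_)
    obtain ⟨x, rfl⟩ := Submodule.Quotient.mk_surjective _ x
    exact congr((fil M n k).mkQ ($(M.d_comp_d i j k) x))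

/-- The projection. -/
def toQuo (M : CochainComplex (ModuleCat.{u} R) ℤ) (n : ℕ) : M ⟶ quo M n where
  f i := ModuleCat.ofHom (fil M n i).mkQ
  comm' i j _ := by
    ext x
    rfl

/-- The transition map. -/
def trans (M : CochainComplex (ModuleCat.{u} R) ℤ) (n : ℕ) : quo M (n+1) ⟶ quo M n where
  f i := ModuleCat.ofHom (Submodule.mapQ _ _ LinearMap.id (fil_succ_le M n i))
  comm' i j _ := by
    ext x
    obtain ⟨x, rfl⟩ := Submodule.Quotient.mk_surjective _ x
    rfl

/-- The tower sequence. -/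
def towerSES (M : CochainComplex (ModuleCat.{u} R) ℤ) :
    ShortComplex (CochainComplex (ModuleCat.{u} R) ℤ) where
  X₁ := M
  X₂ := piC (quo M)
  X₃ := piC (quo M)
  f := piLift (toQuo M)
  g := 𝟙 _ - piLift (fun n => piProj _ (n+1) ≫ trans M n)
  zero := by
    ext i x
    funext n
    change (toQuo M n).f i x - (trans M n).f i ((toQuo M (n+1)).f i x) = 0
    rw [sub_eq_zero]
    rfl

lemma towerSES_shortExact (M : CochainComplex (ModuleCat.{u} R) ℤ) : (towerSES M).ShortExact := by
  apply shortExact_of_elem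
  · intro i
    change Function.Injective ((towerSES M).f.f i).hom
    rw [← LinearMap.ker_eq_bot, eq_bot_iff]
    intro x hx
    have h0 : (fil M (1 - i).toNat i).mkQ x = 0 := congr_fun hx (1 - i).toNat
    have h1 := (Submodule.Quotient.mk_eq_zero _).1 h0
    rw [fil_eq_bot _ _ _ (by lia)] at h1
    exact h1
  · intro i y
    have hs : ∀ n (z : (quo M n).X i), ∃ z', (trans M n).f i z' = z := by
      intro n z
      obtain ⟨x, rfl⟩ := Submodule.Quotient.mk_surjective _ z
      exact ⟨(fil M (n+1) i).mkQ x, rfl⟩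
    choose s hs using hs
    let x : ∀ n, (quo M n).X i := fun n => Nat.rec 0 (fun n z => s n (z - y n)) n
    refine ⟨x, funext fun n => ?_⟩
    change x n - (trans M n).f i (s n (x n - y n)) = y n
    rw [hs]
    exact sub_sub_cancel _ _
  · intro i x hx
    have hx' : ∀ n, x n = (trans M n).f i (x (n+1)) := fun n => sub_eq_zero.1 (congr_fun hx n)
    have hx'' : ∀ n y, (fil M (n+1) i).mkQ y = x (n+1) → (fil M n i).mkQ y = x n := by
      intro n y hy
      rw [hx' n, ← hy]
      rfl
    obtain ⟨y, hy⟩ := Submodule.Quotient.mk_surjective _ (x (1-i).toNat)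
    refine ⟨y, funext fun n => ?_⟩
    change (fil M n i).mkQ y = x n
    rcases le_total n (1-i).toNat with h | h
    · induction h using Nat.decreasingInduction with
      | of_succ k hk ih => exact hx'' _ _ ih
      | self => exact hy
    · induction n, h using Nat.le_induction with
      | base => exact hy
      | succ n hn ih =>
        obtain ⟨z, hz⟩ := Submodule.Quotient.mk_surjective _ (x (n+1))
        have h3 := hx'' n z hz
        rw [← ih] at h3
        rw [← hz]
        have h4 : z = y := by
          have := (Submodule.Quotient.eq _).1 h3
          rw [fil_eq_bot _ _ _ (by lia)] at this
          exact sub_eq_zero.1 this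
        rw [h4]
        rfl

instance (M : CochainComplex (ModuleCat.{u} R) ℤ) (n : ℕ) : (quo M n).IsStrictlyGE (-n) := by
  rw [CochainComplex.isStrictlyGE_iff]
  intro i hi
  refine (ModuleCat.isZero_of_iff_subsingleton (M := M.X i ⧸ fil M n i)).2 ?_
  rw [Submodule.Quotient.subsingleton_iff]
  exact fil_eq_top _ _ _ hi

variable [HasDerivedCategory.{w} (ModuleCat.{u} R)]

lemma isZero_Q_of_acyclic {K : CochainComplex (ModuleCat.{u} R) ℤ} (h : K.Acyclic) :
    IsZero (Q.obj K) := by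
  have : QuasiIso (0 : K ⟶ K) := by
    rw [quasiIso_iff]
    intro i
    rw [quasiIsoAt_iff_exactAt _ _ (h i)]
    exact h i
  have h2 : IsIso (Q.map (0 : K ⟶ K)) := by
    rw [isIso_Q_map_iff_quasiIso]
    exact this
  rw [IsZero.iff_id_eq_zero, ← cancel_epi (Q.map (0 : K ⟶ K))]
  simp

open Pretriangulated in
lemma quasiIso_of_ses {S : ShortComplex (CochainComplex (ModuleCat.{u} R) ℤ)} (hS : S.ShortExact)
    (h : S.X₃.Acyclic) : IsIso (Q.map S.f) := by
  have h1 := triangleOfSES_distinguished hS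
  have := (Triangle.isZero₃_iff_isIso₁ _ h1).1 (by
    change IsZero (Q.obj S.X₃)
    exact isZero_Q_of_acyclic h)
  exact this

lemma exists_kinj_tower (M : CochainComplex (ModuleCat.{u} R) ℤ) :
    ∃ (J : CochainComplex (ModuleCat.{u} R) ℤ) (f : piC (quo M) ⟶ J), J.IsKInjective ∧
      IsIso (Q.map f) := by
  have h n := CochainComplex.Plus.modelCategoryQuillen.exists_mono_quasiIso_injective (quo M n) (-n-1) (-n) (by simp)
  choose I f hf1 hf2 hI hI2 using h
  have hKI n : (I n).IsKInjective := CochainComplex.isKInjective_of_injective _ (-n-1)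
  let T n := ShortComplex.mk (f n) (cokernel.π (f n)) (by simp)
  have hT n : (T n).ShortExact :=
    { exact := ShortComplex.exact_cokernel _
      mono_f := hf1 n
      epi_g := inferInstanceAs (Epi (cokernel.π (f n))) }
  refine ⟨piC I, (piSC T).f, piC_isKInjective _ hKI, quasiIso_of_ses (piSC_shortExact T hT) ?_⟩
  exact piC_acyclic _ fun n => (hT n).acyclic_X₃ (hf2 n)

open Pretriangulated in
/-- Existence of K-injective resolutions. -/
lemma exists_kinj (M : CochainComplex (ModuleCat.{u} R) ℤ) :
    ∃ (I : CochainComplex (ModuleCat.{u} R) ℤ), I.IsKInjective ∧ Nonempty (Q.obj M ≅ Q.obj I) := by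
  obtain ⟨J, f, hJ, hf⟩ := exists_kinj_tower M
  let q := HomotopyCategory.quotient (ModuleCat.{u} R) (.up ℤ)
  let e := quotientCompQhIso (ModuleCat.{u} R)
  obtain ⟨a, ha⟩ := (CochainComplex.IsKInjective.Qh_map_bijective (q.obj J) J).surjective
    (e.hom.app J ≫ inv (Q.map f) ≫ Q.map (towerSES M).g ≫ Q.map f ≫ e.inv.app J)
  obtain ⟨Z, b, c, hT⟩ := distinguished_cocone_triangle₁ a
  have hJ' := (CochainComplex.isKInjective_iff_rightOrthogonal J).1 hJ
  have hZ := ObjectProperty.ext_of_isTriangulatedClosed₁ _ _ hT hJ' hJ'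
  obtain ⟨I, rfl⟩ := HomotopyCategory.quotient_obj_surjective Z
  refine ⟨I, (CochainComplex.isKInjective_iff_rightOrthogonal I).2 hZ, ?_⟩
  have hT' := Qh.map_distinguished _ hT
  have hT2 := triangleOfSES_distinguished (towerSES_shortExact M)
  let eJ : Q.obj (piC (quo M)) ≅ Qh.obj (q.obj J) := asIso (Q.map f) ≪≫ e.symm.app J
  have comm : Q.map (towerSES M).g ≫ eJ.hom = eJ.hom ≫ Qh.map a := by
    rw [ha]
    simp only [eJ, Iso.trans_hom, asIso_hom, Iso.app_hom, Iso.symm_hom, Category.assoc,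
      Iso.inv_hom_id_app_assoc, IsIso.hom_inv_id_assoc]
    rfl
  obtain ⟨t, ht1, ht2⟩ := complete_distinguished_triangle_morphism₁ _ _ hT2 hT' eJ.hom eJ.hom comm
  have := isIso₁_of_isIso₂₃ (Triangle.homMk _ _ t eJ.hom eJ.hom ht1 comm ht2) hT2 hT'
    (inferInstanceAs (IsIso eJ.hom)) (inferInstanceAs (IsIso eJ.hom))
  have : IsIso t := this
  exact ⟨@asIso _ _ _ _ t this ≪≫ e.app I⟩

end Resolution

section Bij

variable {C : Type u₁} [Category.{v₁} C] {D : Type u₂} [Category.{v₂} D]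

/-- `F` is bijective on morphisms from `X` to `M`. -/
def Bij (F : C ⥤ D) (X M : C) : Prop := Function.Bijective (F.map : (X ⟶ M) → _)

lemma Bij.of_iso {F : C ⥤ D} {X M X' M' : C} (h : Bij F X M) (e : X ≅ X') (e' : M ≅ M') :
    Bij F X' M' := by
  constructor
  · intro f g hfg
    rw [← cancel_epi e.hom, ← cancel_mono e'.inv]
    apply h.injective
    simp [hfg]
  · intro f
    obtain ⟨g, hg⟩ := h.surjective (F.map e.hom ≫ f ≫ F.map e'.inv)
    exact ⟨e.inv ≫ g ≫ e'.hom, by simp [hg]⟩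

lemma Bij.shift {F : C ⥤ D} [HasShift C ℤ] [HasShift D ℤ] [F.CommShift ℤ] {X : C}
    (h : ∀ M, Bij F X M) (n : ℤ) (M : C) : Bij F (X⟦n⟧) M := by
  have key (M') : Bij F (X⟦n⟧) (M'⟦n⟧) := by
    have nat {M' : C} (g : X ⟶ M') : F.map (g⟦n⟧') = (F.commShiftIso n).hom.app X ≫ (F.map g)⟦n⟧' ≫
        (F.commShiftIso n).inv.app M' := by
      have := (F.commShiftIso n).hom.naturality g
      dsimp at this
      rw [← reassoc_of% this]
      simp
    constructor
    · intro f g hfg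
      obtain ⟨f, rfl⟩ := (shiftFunctor C n).map_surjective f
      obtain ⟨g, rfl⟩ := (shiftFunctor C n).map_surjective g
      rw [nat, nat, cancel_epi, cancel_mono] at hfg
      rw [(h M').injective ((shiftFunctor D n).map_injective hfg)]
    · intro f
      obtain ⟨g, hg⟩ := (shiftFunctor D n).map_surjective
        ((F.commShiftIso n).inv.app X ≫ f ≫ (F.commShiftIso n).hom.app M')
      obtain ⟨g, rfl⟩ := (h M').surjective g
      refine ⟨g⟦n⟧', ?_⟩
      rw [nat, hg]
      simp
  exact (key (M⟦-n⟧)).of_iso (Iso.refl _) ((shiftFunctorCompIsoId C (-n) n (by simp)).app M)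

end Bij

section A

variable {C : Type u₁} [Category.{v₁} C] [Abelian C]
  {D : Type u₂} [Category.{v₂} D] [Abelian D]
  [HasDerivedCategory.{w₁} C] [HasDerivedCategory.{w₂} D]
  {F : C ⥤ D} [F.Additive] [PreservesFiniteLimits F] [PreservesFiniteColimits F]
  {L : D ⥤ C} [L.Additive] (adj : L ⊣ F)

lemma bij_iff (T M : CochainComplex C ℤ) (P : CochainComplex D ℤ) [P.IsKProjective]
    (e : (L.mapHomologicalComplex (.up ℤ)).obj P ⟶ T)
    (he : IsIso (Q.map ((mapAdj adj (.up ℤ)).homEquiv _ _ e))) :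
    Bij F.mapDerivedCategory (Q.obj T) (Q.obj M) ↔
      Function.Bijective (fun f : Q.obj T ⟶ Q.obj M => Q.map e ≫ f) := by
  let A := mapAdj adj (.up ℤ)
  have hl := left_bijective adj P M
  let p := Q.map (A.homEquiv _ _ e) ≫ F.mapDerivedCategoryFactors.inv.app T
  have hp : IsIso p := inferInstance
  have hp' : Function.Bijective (fun f : F.mapDerivedCategory.obj (Q.obj T) ⟶
      F.mapDerivedCategory.obj (Q.obj M) => p ≫ f) :=
    ⟨fun f g h => (cancel_epi p).1 h, fun f => ⟨inv p ≫ f, by simp⟩⟩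
  rw [Bij, ← hp'.of_comp_iff', ← hl.of_comp_iff']
  have : (fun f : F.mapDerivedCategory.obj (Q.obj T) ⟶
      F.mapDerivedCategory.obj (Q.obj M) => p ≫ f) ∘ F.mapDerivedCategory.map =
    (fun g : Q.obj ((L.mapHomologicalComplex (.up ℤ)).obj P) ⟶ Q.obj M =>
      Q.map ((mapAdj adj (.up ℤ)).unit.app P) ≫ F.mapDerivedCategoryFactors.inv.app _ ≫
      F.mapDerivedCategory.map g) ∘ (fun f : Q.obj T ⟶ Q.obj M => Q.map e ≫ f) := by
    funext f
    have := F.mapDerivedCategoryFactors.inv.naturality e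
    dsimp at this
    simp only [Function.comp, p, Functor.map_comp]
    rw [← reassoc_of% this, A.homEquiv_unit, Q.map_comp, Category.assoc, Category.assoc]
  rw [this]

lemma bij_all_iff (T : CochainComplex C ℤ) (P : CochainComplex D ℤ) [P.IsKProjective]
    (e : (L.mapHomologicalComplex (.up ℤ)).obj P ⟶ T)
    (he : IsIso (Q.map ((mapAdj adj (.up ℤ)).homEquiv _ _ e))) :
    (∀ M, Bij F.mapDerivedCategory (Q.obj T) M) ↔ QuasiIso e := by
  rw [← isIso_Q_map_iff_quasiIso]
  constructor
  · intro h
    rw [isIso_iff_coyoneda_map_bijective]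
    intro M
    have := ((bij_iff adj T (Q.objPreimage M) P e he).1 (h _))
    let i := (Q.objObjPreimageIso M)
    constructor
    · intro f g hfg
      rw [← cancel_mono i.inv]
      apply this.injective
      simpa using congr($hfg ≫ i.inv)
    · intro f
      obtain ⟨g, hg⟩ := this.surjective (f ≫ i.inv)
      refine ⟨g ≫ i.hom, ?_⟩
      dsimp at hg ⊢
      rw [reassoc_of% hg]
      simp
  · intro h M
    refine Bij.of_iso ?_ (Iso.refl _) (Q.objObjPreimageIso M)
    rw [bij_iff adj T _ P e he]
    exact (isIso_iff_coyoneda_map_bijective _).1 h _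

end A

section Gen

variable {S : Type u} [CommRing S]

/-- The free module of rank one in degree `a`. -/
abbrev sing (S : Type u) [CommRing S] (a : ℤ) : CochainComplex (ModuleCat.{u} S) ℤ :=
  (CochainComplex.singleFunctor (ModuleCat.{u} S) a).obj (ModuleCat.of S S)

instance : Projective (ModuleCat.of S S) := (IsProjective.iff_projective S).1 inferInstance

instance (a : ℤ) : (sing S a).IsKProjective := by
  have : ∀ n, Projective ((sing S a).X n) := by
    intro n
    by_cases h : n = a
    · subst h
      exact Projective.of_iso (HomologicalComplex.singleObjXSelf _ _ _).symm inferInstance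
    · exact (HomologicalComplex.isZero_single_obj_X _ _ _ _ h).projective
  exact CochainComplex.isKProjective_of_projective _ a

variable [HasDerivedCategory.{w} (ModuleCat.{u} S)]

lemma acyclic_of_hom_zero (W : CochainComplex (ModuleCat.{u} S) ℤ)
    (h : ∀ a (f : Q.obj (sing S a) ⟶ Q.obj W), f = 0) : W.Acyclic := by
  rw [acyclic_iff]
  rintro i j k hi hk x hx
  let a : sing S j ⟶ W := HomologicalComplex.mkHomFromSingle
    (ModuleCat.ofHom (LinearMap.toSpanSingleton S (W.X j) x)) (by
      rintro k' hk'
      obtain rfl : k = k' := hk.symm.trans hk'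
      ext
      simpa using hx)
  obtain ⟨H⟩ := homotopy_of_proj (f := a) (g := 0) (by rw [h j (Q.map a)]; simp)
  have h1 := H.comm j
  rw [dNext_eq _ (show (ComplexShape.up ℤ).Rel j k from hk),
    prevD_eq _ (show (ComplexShape.up ℤ).Rel i j from hi)] at h1
  have h2 := congr((HomologicalComplex.singleObjXSelf (.up ℤ) j (ModuleCat.of S S)).inv ≫ $h1)
  simp [a] at h2
  have h3 := congr($h2 (1 : S))
  simp at h3
  exact ⟨_, h3.symm⟩

lemma inj_shift {E : Type*} [Category E] [Preadditive E] [HasShift E ℤ]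
    [∀ n : ℤ, (shiftFunctor E n).Additive] {X M N : E} (u : M ⟶ N)
    (h : ∀ f : X⟦(-1 : ℤ)⟧ ⟶ M, f ≫ u = 0 → f = 0) (g : X ⟶ M⟦(1 : ℤ)⟧)
    (hg : g ≫ u⟦(1 : ℤ)⟧' = 0) : g = 0 := by
  let adj : shiftFunctor E (-1 : ℤ) ⊣ shiftFunctor E (1 : ℤ) :=
    (shiftEquiv' E (-1 : ℤ) 1 (by simp)).toAdjunction
  have h1 : (adj.homEquiv X M).symm g = 0 := by
    apply h
    have := adj.homEquiv_naturality_right_symm g u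
    rw [← this]
    rw [hg, adj.homEquiv_counit, Functor.map_zero, zero_comp]
  rw [← (adj.homEquiv X M).apply_symm_apply g, h1, adj.homEquiv_unit, Functor.map_zero, comp_zero]

open Pretriangulated in
lemma isIso_of_bij (X : ℤ → DerivedCategory (ModuleCat.{u} S))
    (hX : ∀ a, Nonempty (Q.obj (sing S a) ≅ X a)) (hX' : ∀ a, Nonempty ((X a)⟦(-1 : ℤ)⟧ ≅ X (a + 1)))
    {M N : DerivedCategory (ModuleCat.{u} S)} (u : M ⟶ N)
    (h : ∀ a, Function.Bijective (fun f : X a ⟶ M => f ≫ u)) : IsIso u := by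
  obtain ⟨W, v, w, hT⟩ := distinguished_cocone_triangle u
  have hW : ∀ a (f : X a ⟶ W), f = 0 := by
    intro a f
    have h31 : w ≫ u⟦(1 : ℤ)⟧' = 0 := comp_distTriang_mor_zero₃₁ _ hT
    have h12 : u ≫ v = 0 := comp_distTriang_mor_zero₁₂ _ hT
    have h1 : f ≫ w = 0 := by
      refine inj_shift u ?_ (f ≫ w) (by rw [Category.assoc, h31, comp_zero])
      intro g hg
      obtain ⟨i⟩ := hX' a
      rw [← cancel_epi i.inv]
      apply (h (a + 1)).injective
      simp [hg]
    obtain ⟨g, rfl⟩ := Triangle.coyoneda_exact₃ _ hT f h1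
    obtain ⟨g', rfl⟩ := (h a).surjective g
    change (g' ≫ u) ≫ v = 0
    rw [Category.assoc, h12, comp_zero]
  have : IsZero W := by
    refine IsZero.of_iso ?_ (Q.objObjPreimageIso W).symm
    apply isZero_Q_of_acyclic
    apply acyclic_of_hom_zero
    intro a f
    obtain ⟨i⟩ := hX a
    rw [← cancel_epi i.inv, ← cancel_mono (Q.objObjPreimageIso W).hom]
    have := hW a (i.inv ≫ f ≫ (Q.objObjPreimageIso W).hom)
    simp [this]
  exact (Triangle.isZero₃_iff_isIso₁ _ hT).1 this

end Gen

section Main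

variable {R S : Type u} [CommRing R] [CommRing S]
  [HasDerivedCategory.{w} (ModuleCat.{u} R)] [HasDerivedCategory.{w} (ModuleCat.{u} S)]
  {F : ModuleCat.{u} S ⥤ ModuleCat.{u} R} [F.Additive] [PreservesFiniteLimits F]
  [PreservesFiniteColimits F]
  {G : ModuleCat.{u} R ⥤ ModuleCat.{u} S} [G.Additive]

lemma sing_shift (a : ℤ) : Nonempty ((Q.obj (sing S a))⟦(-1 : ℤ)⟧ ≅ Q.obj (sing S (a + 1))) :=
  ⟨((Q.commShiftIso (-1 : ℤ)).app _).symm ≪≫ Q.mapIso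
    (((CochainComplex.singleFunctors (ModuleCat.{u} S)).shiftIso (-1) (a+1) a (by simp)).app
      (ModuleCat.of S S))⟩

lemma sing_shift' (a : ℤ) : Nonempty ((Q.obj (sing S 0))⟦-a⟧ ≅ Q.obj (sing S a)) :=
  ⟨((Q.commShiftIso (-a)).app _).symm ≪≫ Q.mapIso
    (((CochainComplex.singleFunctors (ModuleCat.{u} S)).shiftIso (-a) a 0 (by simp)).app
      (ModuleCat.of S S))⟩

lemma bij_of_sing (adj : F ⊣ G) (h : ∀ M, Bij F.mapDerivedCategory (Q.obj (sing S 0)) M)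
    (Y M : DerivedCategory (ModuleCat.{u} S)) : Bij F.mapDerivedCategory Y M := by
  have h' (a M) : Bij F.mapDerivedCategory (Q.obj (sing S a)) M := by
    obtain ⟨i⟩ := sing_shift' (S := S) a
    exact (Bij.shift h (-a) M).of_iso i (Iso.refl _)
  suffices ∀ Y M : CochainComplex (ModuleCat.{u} S) ℤ,
      Bij F.mapDerivedCategory (Q.obj Y) (Q.obj M) from
    (this (Q.objPreimage Y) (Q.objPreimage M)).of_iso (Q.objObjPreimageIso Y)
      (Q.objObjPreimageIso M)
  clear Y M
  intro Y M
  obtain ⟨I, hI, ⟨i⟩⟩ := exists_kinj ((F.mapHomologicalComplex (.up ℤ)).obj M)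
  let θ := F.mapDerivedCategoryFactors.app M ≪≫ i
  obtain ⟨u, hu⟩ := (right_bijective adj M I).surjective θ.hom
  have key (Y : CochainComplex (ModuleCat.{u} S) ℤ) :
      Bij F.mapDerivedCategory (Q.obj Y) (Q.obj M) ↔
        Function.Bijective (fun f : Q.obj Y ⟶ Q.obj M => f ≫ u) := by
    have hθ : Function.Bijective (fun f : F.mapDerivedCategory.obj (Q.obj Y) ⟶
        F.mapDerivedCategory.obj (Q.obj M) => f ≫ θ.hom) :=
      ⟨fun f g h => (cancel_mono θ.hom).1 h, fun f => ⟨f ≫ θ.inv, by simp⟩⟩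
    rw [Bij, ← hθ.of_comp_iff', ← (right_bijective adj Y I).of_comp_iff']
    apply iff_of_eq
    congr 1
    funext f
    dsimp at hu ⊢
    rw [← hu, Functor.map_comp, Category.assoc]
  have : IsIso u := isIso_of_bij (fun a => Q.obj (sing S a)) (fun a => ⟨Iso.refl _⟩)
    sing_shift u (fun a => (key _).1 (h' a _))
  rw [key]
  exact ⟨fun f g h => (cancel_mono u).1 h, fun f => ⟨f ≫ inv u, by simp⟩⟩

end Main

section P4

variable {C : Type u₁} [Category.{v₁} C] [Abelian C]
  {D : Type u₂} [Category.{v₂} D] [Abelian D] (L : D ⥤ C) [L.Additive]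

lemma exactAt_cochain_iff {X : D} (P : ProjectiveResolution X) (k : ℕ) :
    ((L.mapHomologicalComplex (.up ℤ)).obj P.cochainComplex).ExactAt (-((k + 1 : ℕ) : ℤ)) ↔
      ((L.mapHomologicalComplex (.down ℕ)).obj P.complex).ExactAt (k + 1) := by
  rw [HomologicalComplex.exactAt_iff' _ (-((k + 2 : ℕ) : ℤ)) _ (-(k : ℤ)) (by simp; lia) (by simp),
    HomologicalComplex.exactAt_iff' _ (k + 2) (k + 1) k (by simp) (by simp)]
  refine ShortComplex.exact_iff_of_iso ?_
  refine ShortComplex.isoMk (L.mapIso (P.cochainComplexXIso _ (k + 2)))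
    (L.mapIso (P.cochainComplexXIso _ (k + 1))) (L.mapIso (P.cochainComplexXIso _ k)) ?_ ?_
  · change L.map _ ≫ L.map (P.complex.d (k + 2) (k + 1)) = L.map (P.cochainComplex.d
      (-((k + 2 : ℕ) : ℤ)) (-((k + 1 : ℕ) : ℤ))) ≫ L.map _
    rw [← L.map_comp, ← L.map_comp, P.cochainComplex_d _ _ (k + 2) (k + 1) rfl rfl]
    simp
  · change L.map _ ≫ L.map (P.complex.d (k + 1) k) = L.map (P.cochainComplex.d
      (-((k + 1 : ℕ) : ℤ)) (-(k : ℤ))) ≫ L.map _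
    rw [← L.map_comp, ← L.map_comp, P.cochainComplex_d _ _ (k + 1) k rfl rfl]
    simp

lemma exactAt_pos {X : D} (P : ProjectiveResolution X) (n : ℤ) (hn : 0 < n) :
    ((L.mapHomologicalComplex (.up ℤ)).obj P.cochainComplex).ExactAt n := by
  rw [HomologicalComplex.exactAt_iff]
  apply ShortComplex.exact_of_isZero_X₂
  exact L.map_isZero (CochainComplex.isZero_of_isStrictlyLE _ 0 _ hn)

lemma exactAt_iff_map {C' : Type*} [Category C'] [Abelian C'] (F : C ⥤ C') [F.Additive]
    [F.PreservesHomology] [F.Faithful] {N : D ⥤ C'} [N.Additive] (i : L ⋙ F ≅ N)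
    (K : ChainComplex D ℕ) (k : ℕ) :
    ((L.mapHomologicalComplex (.down ℕ)).obj K).ExactAt k ↔
    ((N.mapHomologicalComplex (.down ℕ)).obj K).ExactAt k := by
  rw [HomologicalComplex.exactAt_iff, HomologicalComplex.exactAt_iff,
    ← ShortComplex.exact_map_iff_of_faithful _ F]
  refine ShortComplex.exact_iff_of_iso ?_
  exact ShortComplex.isoMk (i.app _) (i.app _) (i.app _) (i.hom.naturality _).symm
    (i.hom.naturality _).symm

end P4

section P5

variable {R S : Type u} [CommRing R] [CommRing S] (φ : R →+* S)

/-- Extension of scalars, as a linear equivalence. -/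
def extEquiv (M : ModuleCat.{u} R) :
    ((ModuleCat.extendScalars.{u,u,u} φ ⋙ ModuleCat.restrictScalars φ).obj M) ≃ₗ[R]
    (((MonoidalCategory.tensoringLeft (ModuleCat.{u} R)).obj (SasR φ)).obj M) :=
    { toFun := fun x => x
      invFun := fun x => x
      left_inv := fun _ => rfl
      right_inv := fun _ => rfl
      map_add' := fun _ _ => rfl
      map_smul' := fun r x => by
        induction x using TensorProduct.induction_on with
        | zero =>
          have h1 := smul_zero (A := ((ModuleCat.extendScalars.{u,u,u} φ ⋙
            ModuleCat.restrictScalars φ).obj M)) r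
          have h2 := smul_zero (A := TensorProduct R (SasR φ) M) r
          exact h1.trans h2.symm
        | add x y hx hy =>
          erw [smul_add, hx, hy]
        | tmul s m => rfl }

/-- Extension of scalars, as a tensor product. -/
def extIso : ModuleCat.extendScalars.{u,u,u} φ ⋙ ModuleCat.restrictScalars φ ≅
    (MonoidalCategory.tensoringLeft (ModuleCat.{u} R)).obj (SasR φ) :=
  NatIso.ofComponents (fun M => LinearEquiv.toModuleIso (extEquiv φ M))
    (fun f => rfl)

lemma tor_iff (P : ProjectiveResolution (SasR φ)) (k : ℕ) :
    IsZero (((Tor (ModuleCat.{u} R) k).obj (SasR φ)).obj (SasR φ)) ↔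
    ((((MonoidalCategory.tensoringLeft (ModuleCat.{u} R)).obj (SasR φ)).mapHomologicalComplex
      (.down ℕ)).obj P.complex).ExactAt k := by
  rw [HomologicalComplex.exactAt_iff_isZero_homology]
  exact (P.isoLeftDerivedObj _ k).isZero_iff

lemma exact_epi_iff {A B Z Y : ModuleCat.{u} S} (f : A ⟶ B) (g : B ⟶ Z) (c : Z ⟶ Y)
    (w : f ≫ g = 0) (h : (ShortComplex.mk f g w).Exact) [Epi g] (w' : f ≫ g ≫ c = 0) :
    ((ShortComplex.mk f (g ≫ c) w').Exact ∧ Epi (g ≫ c)) ↔ IsIso c := by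
  constructor
  · rintro ⟨h1, h2⟩
    have : Epi c := epi_of_epi g c
    have : Mono c := by
      rw [ModuleCat.mono_iff_injective, injective_iff_map_eq_zero]
      intro z hz
      obtain ⟨b, rfl⟩ := (ModuleCat.epi_iff_surjective g).1 inferInstance z
      rw [ShortComplex.moduleCat_exact_iff] at h1
      obtain ⟨a, ha⟩ := h1 b hz
      rw [← ha]
      exact ConcreteCategory.congr_hom w a
    exact isIso_of_mono_of_epi c
  · intro _
    refine ⟨?_, inferInstance⟩
    refine (ShortComplex.exact_iff_of_iso (S₁ := ShortComplex.mk f g w) ?_).1 h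
    exact ShortComplex.isoMk (Iso.refl _) (Iso.refl _) (asIso c) (by simp) (by simp)

lemma counit_iff : IsIso ((ModuleCat.extendRestrictScalarsAdj.{u,u,u} φ).counit.app (ModuleCat.of S S)) ↔
    Function.Bijective (mulMap φ) := by
  rw [ConcreteCategory.isIso_iff_bijective]
  have : ∀ x : TensorProduct R (SasR φ) (SasR φ),
    (ModuleCat.extendRestrictScalarsAdj.{u,u,u} φ).counit.app (ModuleCat.of S S) x = mulMap φ x := by
    intro x
    induction x using TensorProduct.induction_on with
    | zero => rw [map_zero]; exact map_zero _
    | add x y hx hy => rw [map_add, ← hx, ← hy]; exact map_add _ _ _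
    | tmul s m => rfl
  rw [← show ⇑((ModuleCat.extendRestrictScalarsAdj.{u,u,u} φ).counit.app (ModuleCat.of S S)) = mulMap φ from funext this]
  rfl

end P5

section P6

variable {R S : Type u} [CommRing R] [CommRing S] (φ : R →+* S)

instance : (ModuleCat.extendScalars.{u,u,u} φ).Additive :=
  (ModuleCat.extendRestrictScalarsAdj.{u,u,u} φ).left_adjoint_additive

instance : (ModuleCat.coextendScalars.{u,u,u} φ).Additive :=
  (ModuleCat.restrictCoextendScalarsAdj.{u,u,u} φ).right_adjoint_additive

/-- The resolution map. -/
def resMap (P : ProjectiveResolution (SasR φ)) : P.cochainComplex ⟶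
    ((ModuleCat.restrictScalars.{u} φ).mapHomologicalComplex (.up ℤ)).obj (sing S 0) :=
  P.π' ≫ (HomologicalComplex.singleMapHomologicalComplex (ModuleCat.restrictScalars.{u} φ)
    (ComplexShape.up ℤ) 0).inv.app (ModuleCat.of S S)

instance (P : ProjectiveResolution (SasR φ)) : QuasiIso (resMap φ P) := by
  unfold resMap
  have h1 : QuasiIso P.π' := inferInstance
  have h2 : IsIso ((HomologicalComplex.singleMapHomologicalComplex (ModuleCat.restrictScalars.{u} φ)
    (ComplexShape.up ℤ) 0).inv.app (ModuleCat.of S S)) := inferInstance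
  have h3 := quasiIso_of_isIso ((HomologicalComplex.singleMapHomologicalComplex
    (ModuleCat.restrictScalars.{u} φ) (ComplexShape.up ℤ) 0).inv.app (ModuleCat.of S S))
  exact quasiIso_comp (hφ := h1) (hφ' := h3)

/-- Its adjoint. -/
def eMap (P : ProjectiveResolution (SasR φ)) :
    ((ModuleCat.extendScalars.{u,u,u} φ).mapHomologicalComplex (.up ℤ)).obj P.cochainComplex ⟶
      sing S 0 :=
  ((mapAdj (ModuleCat.extendRestrictScalarsAdj.{u,u,u} φ) (.up ℤ)).homEquiv _ _).symm (resMap φ P)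

lemma eMap_f (P : ProjectiveResolution (SasR φ)) (n : ℤ) :
    (eMap φ P).f n = (ModuleCat.extendScalars.{u,u,u} φ).map ((resMap φ P).f n) ≫
      (ModuleCat.extendRestrictScalarsAdj.{u,u,u} φ).counit.app ((sing S 0).X n) := by
  unfold eMap
  rw [Adjunction.homEquiv_counit]
  rfl

lemma sing_exactAt (n : ℤ) (hn : n ≠ 0) : (sing S 0).ExactAt n :=
  HomologicalComplex.exactAt_single_obj _ _ _ _ hn

lemma quasiIsoAt_ne (P : ProjectiveResolution (SasR φ)) (k : ℕ) :
    QuasiIsoAt (eMap φ P) (-((k + 1 : ℕ) : ℤ)) ↔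
      IsZero (((Tor (ModuleCat.{u} R) (k + 1)).obj (SasR φ)).obj (SasR φ)) := by
  rw [quasiIsoAt_iff_exactAt' _ _ (sing_exactAt _ (by lia)), exactAt_cochain_iff, tor_iff φ P,
    exactAt_iff_map _ (ModuleCat.restrictScalars.{u} φ) (extIso φ)]

lemma quasiIsoAt_pos (P : ProjectiveResolution (SasR φ)) (n : ℤ) (hn : 0 < n) :
    QuasiIsoAt (eMap φ P) n := by
  rw [quasiIsoAt_iff_exactAt' _ _ (sing_exactAt _ (by lia))]
  exact exactAt_pos _ P n hn

lemma sc_iff {A : Type*} [Category A] [Abelian A] {K T : CochainComplex A ℤ} (f : K ⟶ T)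
    (hK : IsZero (K.X 1)) (h1 : IsZero (T.X 1)) (h0 : IsZero (T.X (-1))) :
    QuasiIsoAt f 0 ↔ (ShortComplex.mk (K.d (-1) 0) (f.f 0)
      (by rw [← f.comm, h0.eq_of_src (T.d (-1) 0) 0, comp_zero])).Exact ∧ Epi (f.f 0) := by
  rw [quasiIsoAt_iff' f (-1) 0 1 (by simp) (by simp)]
  exact ShortComplex.quasiIso_iff_of_zeros' _ (hK.eq_of_tgt _ _) (h0.eq_of_src _ _)
    (h1.eq_of_tgt _ _)

lemma sing_isZero (n : ℤ) (hn : n ≠ 0) : IsZero ((sing S 0).X n) :=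
  HomologicalComplex.isZero_single_obj_X _ _ _ _ hn

lemma exact_epi_iff' {A B Z Y : ModuleCat.{u} S} (f : A ⟶ B) (g : B ⟶ Z) (c : Z ⟶ Y) (gc : B ⟶ Y)
    (hgc : gc = g ≫ c) (w : f ≫ g = 0) (h : (ShortComplex.mk f g w).Exact) (hg : Epi g)
    (w' : f ≫ gc = 0) :
    ((ShortComplex.mk f gc w').Exact ∧ Epi gc) ↔ IsIso c := by
  subst hgc
  exact exact_epi_iff f g c w h w'

lemma quasiIsoAt_zero (P : ProjectiveResolution (SasR φ)) :
    QuasiIsoAt (eMap φ P) 0 ↔ Function.Bijective (mulMap φ) := by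
  have hP : IsZero (P.cochainComplex.X 1) :=
    CochainComplex.isZero_of_isStrictlyLE _ 0 _ (by lia)
  have h1 := (sc_iff (resMap φ P) hP 
    (Functor.map_isZero (ModuleCat.restrictScalars.{u} φ) (sing_isZero 1 (by lia)))
    (Functor.map_isZero (ModuleCat.restrictScalars.{u} φ) (sing_isZero (-1) (by lia)))).1 inferInstance
  obtain ⟨hex, hepi⟩ := h1
  have hl : PreservesColimitsOfSize.{0,0} (ModuleCat.extendScalars.{u,u,u} φ) :=
    (ModuleCat.extendRestrictScalarsAdj.{u,u,u} φ).leftAdjoint_preservesColimits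
  have hex' := hex.map_of_epi_of_preservesCokernel (ModuleCat.extendScalars.{u,u,u} φ)
    hepi inferInstance
  have hepi' : Epi ((ModuleCat.extendScalars.{u,u,u} φ).map ((resMap φ P).f 0)) := inferInstance
  rw [sc_iff (eMap φ P) (Functor.map_isZero (ModuleCat.extendScalars.{u,u,u} φ) hP) (sing_isZero 1 (by lia))
    (sing_isZero (-1) (by lia)), ← counit_iff]
  refine (exact_epi_iff' _ _ ((ModuleCat.extendRestrictScalarsAdj.{u,u,u} φ).counit.app
    ((sing S 0).X 0)) _ (eMap_f φ P 0) _ hex' hepi' _).trans ?_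
  exact NatTrans.isIso_app_iff_of_iso _ (HomologicalComplex.singleObjXSelf _ _ _)

lemma quasiIso_eMap (P : ProjectiveResolution (SasR φ)) :
    QuasiIso (eMap φ P) ↔ (Function.Bijective (mulMap φ) ∧
      ∀ i : ℕ, 1 ≤ i → IsZero (((Tor (ModuleCat.{u} R) i).obj (SasR φ)).obj (SasR φ))) := by
  rw [← quasiIsoAt_zero φ P, quasiIso_iff]
  constructor
  · intro h
    refine ⟨h 0, fun i hi => ?_⟩
    obtain ⟨k, rfl⟩ := Nat.exists_eq_add_of_le' hi
    exact (quasiIsoAt_ne φ P k).1 (h _)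
  · rintro ⟨h, h'⟩ n
    rcases lt_trichotomy n 0 with hn | rfl | hn
    · obtain ⟨k, rfl⟩ : ∃ k : ℕ, n = -((k + 1 : ℕ) : ℤ) := ⟨(-n-1).toNat, by lia⟩
      exact (quasiIsoAt_ne φ P k).2 (h' _ (by lia))
    · exact h
    · exact quasiIsoAt_pos φ P n hn

variable [HasDerivedCategory.{w} (ModuleCat.{u} R)] [HasDerivedCategory.{w} (ModuleCat.{u} S)]

lemma main_iff :
    (Function.Bijective (mulMap φ) ∧
      ∀ i : ℕ, 1 ≤ i → IsZero (((Tor (ModuleCat.{u} R) i).obj (SasR φ)).obj (SasR φ))) ↔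
    ((Dphi φ).Full ∧ (Dphi φ).Faithful) := by
  let P : ProjectiveResolution (SasR φ) := projectiveResolution _
  have he : IsIso (Q.map ((mapAdj (ModuleCat.extendRestrictScalarsAdj.{u,u,u} φ)
      (.up ℤ)).homEquiv _ _ (eMap φ P))) := by
    unfold eMap
    rw [Equiv.apply_symm_apply]
    infer_instance
  rw [← quasiIso_eMap φ P, ← bij_all_iff (ModuleCat.extendRestrictScalarsAdj.{u,u,u} φ) _ _ _ he]
  constructor
  · intro h
    have := bij_of_sing (ModuleCat.restrictCoextendScalarsAdj.{u,u,u} φ) h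
    exact ⟨⟨fun {X Y} => (this X Y).2⟩, ⟨fun {X Y} => fun a b => (this X Y).1 (a₁ := a) (a₂ := b)⟩⟩
  · rintro ⟨h1, h2⟩ M
    exact ⟨(Dphi φ).map_injective, (Dphi φ).map_surjective⟩

end P6

/-- For a homomorphism `φ : R →+* S` of commutative rings, the multiplication map
`μ : S ⊗_R S → S` is bijective and `Tor_i^R(S,S) = 0` for all `i ≥ 1` if and only if the
functor `D(φ) : D(S) → D(R)` induced by restriction of scalars is fully faithful. -/
theorem mul_bijective_and_tor_vanishing_iff_derived_fully_faithful :
    (Function.Bijective (mulMap φ) ∧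
      ∀ i : ℕ, 1 ≤ i →
        IsZero (((Tor (ModuleCat.{u} R) i).obj (SasR φ)).obj (SasR φ))) ↔
    ((Dphi φ).Full ∧ (Dphi φ).Faithful) := by
  exact main_iff φ

end RingHomEpi
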